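/- (i) For every x ∈ X_{S,q}, the integer i^S divides m_x. (ii) If x ∈ X_{S,q} is idealistic, then m_x = i^S. -/

import Mathlib

open scoped Pointwise Classical
open Matrix NumberField

noncomputable section

namespace AD

/-- The set `Y` of column vectors `(a,b)ᵀ ∈ K²` with `b ≠ 0` and `a/b ∉ ℚ`. -/
def Y (K : Type*) [Field K] [NumberField K] : Set (Fin 2 → K) :=
  {y | y 1 ≠ 0 ∧ ∀ r : ℚ, y 0 ≠ algebraMap ℚ K r * y 1}

/-- The elements of `Y`, as a type. -/
def Ysub (K : Type*) [Field K] [NumberField K] := {y : Fin 2 → K // y ∈ Y K}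

/-- The lattice `Λ_y = ℤ·(y 0) + ℤ·(y 1)` spanned by the entries of `y`. -/
def lat {K : Type*} [Field K] [NumberField K] (y : Fin 2 → K) : Submodule ℤ K :=
  Submodule.span ℤ {y 0, y 1}

/-- A lattice in `K`: a free `ℤ`-submodule of rank `2`; equivalently (since `K` is a
`2`-dimensional `ℚ`-vector space) the `ℤ`-span of a pair of `ℚ`-linearly independent
elements of `K`. -/
def IsLat {K : Type*} [Field K] [NumberField K] (L : Submodule ℤ K) : Prop :=
  ∃ y : Fin 2 → K, LinearIndependent ℚ y ∧ L = lat y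

/-- Scaling of a `ℤ`-submodule of `K` by `c ∈ K`:  `c • L`. -/
def smulLat {K : Type*} [Field K] [NumberField K] (c : K) (L : Submodule ℤ K) :
    Submodule ℤ K :=
  L.map (LinearMap.mulLeft ℤ c)

/-- The (left) action of a rational `2 × 2` matrix on column vectors in `K²`. -/
def act {K : Type*} [Field K] [NumberField K] (g : Matrix (Fin 2) (Fin 2) ℚ)
    (y : Fin 2 → K) : Fin 2 → K :=
  (g.map (algebraMap ℚ K)).mulVec y

/-- The right scalar action of `K` on column vectors in `K²`: `y·c`. -/
def rsc {K : Type*} [Field K] [NumberField K] (y : Fin 2 → K) (c : K) : Fin 2 → K :=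
  fun i => y i * c

/-- `GL(2,ℤ)`, viewed as the set of rational `2 × 2` matrices with integral entries
and determinant `±1`. -/
def GLZset : Set (Matrix (Fin 2) (Fin 2) ℚ) :=
  {g | (∀ i j, ∃ a : ℤ, g i j = (a : ℚ)) ∧ (g.det = 1 ∨ g.det = -1)}

end AD
namespace AD

/-- Reduction of a rational number modulo `n` (this is the genuine reduction whenever the
denominator is coprime to `n`). -/
def ratRed (n : ℕ) (r : ℚ) : ZMod n := (r.num : ZMod n) * ((r.den : ZMod n))⁻¹

/-- `S₀(n)`: the largest subgroup of `GL(2,ℚ)` that can be mapped modulo `n` to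
`GL(2,ℤ/nℤ)`, i.e. the invertible rational matrices which are `n`-integral and whose
reduction modulo `n` is invertible. -/
def S0set (n : ℕ) : Set (Matrix (Fin 2) (Fin 2) ℚ) :=
  {g | IsUnit g.det ∧ (∀ i j, Nat.Coprime (g i j).den n) ∧ IsUnit (g.map (ratRed n)).det}

/-- `S = S(m) ∩ S₀(n)`: the elements of `S₀(n)` reducing to the identity modulo `m`. -/
def Sset (n m : ℕ) : Set (Matrix (Fin 2) (Fin 2) ℚ) :=
  {g | g ∈ S0set n ∧ g.map (ratRed m) = 1}

/-- `p`: the characteristic of `𝔽` when it is positive, and `1` when `char 𝔽 = 0`. -/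
def pOf (𝔽 : Type*) [Field 𝔽] : ℕ := if ringChar 𝔽 = 0 then 1 else ringChar 𝔽

/-- The quantity `p·d·N` where `d` is (the absolute value of) the discriminant of `K`. -/
def pdN (𝔽 : Type*) [Field 𝔽] (K : Type*) [Field K] [NumberField K] (N : ℕ) : ℕ :=
  pOf 𝔽 * (NumberField.discr K).natAbs * N

/-- `K_{S₀}` (for the level `n`): the set of `c ∈ K^×` such that `r_ω̄(c) ∈ S₀(n)`, where
`r_ω̄(c)` is the unique rational matrix with `r_ω̄(c)·ω̄ = ω̄·c` and `ω̄ = (ω,1)ᵀ`. -/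
def KS0set (K : Type*) [Field K] [NumberField K] (n : ℕ) (ω : K) : Set K :=
  {c | ∃ g ∈ S0set n, act g ![ω, 1] = rsc ![ω, 1] c}

/-- `K_S`: the set of `c ∈ K^×` with `r_ω̄(c) ∈ S = S(m) ∩ S₀(n)`. -/
def KSset (K : Type*) [Field K] [NumberField K] (n m : ℕ) (ω : K) : Set K :=
  {c | ∃ g ∈ Sset n m, act g ![ω, 1] = rsc ![ω, 1] c}

/-- The rational prime `ℓ` is inert in `K`: `ℓ𝒪` is a prime ideal of `𝒪`. -/
def IsInert (K : Type*) [Field K] [NumberField K] (ℓ : ℕ) : Prop :=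
  ℓ.Prime ∧ (Ideal.span {(ℓ : 𝓞 K)}).IsPrime

/-- The total multiplicity of the inert primes in the factorization of `n`. -/
def inertMultNat (K : Type*) [Field K] [NumberField K] (n : ℕ) : ℕ :=
  n.factorization.sum fun ℓ e => if IsInert K ℓ then e else 0

/-- The value `q(rI) = θ(r)` of the quadratic Dirichlet character `θ` cutting out the real
quadratic field `K` (characterized by `θ(-1) = 1`, `θ(ℓ) = 1` for `ℓ` split, `θ(ℓ) = -1`
for `ℓ` inert, extended multiplicatively), taken in `𝔽`. -/
def qRat (K : Type*) [Field K] [NumberField K] (𝔽 : Type*) [Field 𝔽] (r : ℚ) : 𝔽 :=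
  (-1) ^ (inertMultNat K r.num.natAbs + inertMultNat K r.den)

/-- The number (with multiplicity) of inert prime ideal factors of the ideal `(x)`. -/
def inertCount (K : Type*) [Field K] [NumberField K] (x : 𝓞 K) : ℕ :=
  Multiset.countP (fun P => ∃ ℓ : ℕ, IsInert K ℓ ∧ P = Ideal.span {(ℓ : 𝓞 K)})
    (UniqueFactorizationMonoid.factors (Ideal.span {x}))

/-- `q^*(α)`: the product, over the inert prime ideals `(ℓ)` occurring in the prime
factorization of the fractional ideal `α𝒪`, of `q(ℓI) = -1` raised to the corresponding
exponent. -/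
def qstar (K : Type*) [Field K] [NumberField K] (𝔽 : Type*) [Field 𝔽] (α : K) : 𝔽 :=
  (-1) ^ (inertCount K (IsLocalization.sec (nonZeroDivisors (𝓞 K)) α).1 +
      inertCount K ((IsLocalization.sec (nonZeroDivisors (𝓞 K)) α).2 : 𝓞 K))

/-- `K_{S,q}`: the kernel of `q^*` restricted to `K_S`. -/
def KSqSet (K : Type*) [Field K] [NumberField K] (𝔽 : Type*) [Field 𝔽] (n m : ℕ)
    (ω : K) : Set K :=
  {c | c ∈ KSset K n m ω ∧ qstar K 𝔽 c = 1}

/-- The scalars of the elements of `Z`: the matrix `rI` belongs to `Z` iff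
`r ∈ ℚ^× ∩ K_{S₀}`. -/
def Zscal (K : Type*) [Field K] [NumberField K] (n : ℕ) (ω : K) : Set ℚ :=
  {r | r ≠ 0 ∧ algebraMap ℚ K r ∈ KS0set K n ω}

end AD
namespace AD

/-- A `ℤ`-submodule of `K` is a fractional ideal of `K` iff (being nonzero and finitely
generated) its underlying set is an `𝒪`-submodule of `K`. -/
def IsIdealistic (K : Type*) [Field K] [NumberField K] (L : Submodule ℤ K) : Prop :=
  ∃ J : Submodule (𝓞 K) K, (J : Set K) = (L : Set K)

/-- The subgroup of units of `𝓞 K` that are congruent to `1` or `-1` modulo `m`. -/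
def unitsCongrSign (K : Type*) [Field K] [NumberField K] (m : ℕ) : Subgroup (𝓞 K)ˣ where
  carrier := {u | (m : 𝓞 K) ∣ u - 1 ∨ (m : 𝓞 K) ∣ u + 1}
  one_mem' := by simp
  mul_mem' := by
    rintro u v (⟨a, ha⟩ | ⟨a, ha⟩) (⟨b, hb⟩ | ⟨b, hb⟩)
    · exact Or.inl ⟨a * v + b, by push_cast; linear_combination (v : 𝓞 K) * ha + hb⟩
    · exact Or.inr ⟨a * v + b, by push_cast; linear_combination (v : 𝓞 K) * ha + hb⟩
    · exact Or.inr ⟨a * v - b, by push_cast; linear_combination (v : 𝓞 K) * ha - hb⟩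
    · exact Or.inl ⟨a * v - b, by push_cast; linear_combination (v : 𝓞 K) * ha - hb⟩
  inv_mem' := by
    rintro u (⟨a, ha⟩ | ⟨a, ha⟩)
    · exact Or.inl ⟨-a * (u⁻¹ : (𝓞 K)ˣ), by
        linear_combination (-(u⁻¹ : (𝓞 K)ˣ) : 𝓞 K) * ha + u.mul_inv⟩
    · exact Or.inr ⟨a * (u⁻¹ : (𝓞 K)ˣ), by
        linear_combination ((u⁻¹ : (𝓞 K)ˣ) : 𝓞 K) * ha - u.mul_inv⟩

section Lemmas

variable {K : Type*} [Field K] [NumberField K]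

theorem exists_eq_add_mul_of_adjoin_eq_top (hdeg : Module.finrank ℚ K = 2) {ω : 𝓞 K}
    (hω : Algebra.adjoin ℤ {ω} = ⊤) (x : 𝓞 K) : ∃ a b : ℤ, x = a + b * ω := by
  have hint : IsIntegral ℤ ω := RingOfIntegers.isIntegral ω
  have hx : x ∈ Algebra.adjoin ℤ {ω} := hω ▸ Algebra.mem_top
  rw [Algebra.adjoin_singleton_eq_range_aeval] at hx
  obtain ⟨p, rfl⟩ := hx
  have hmonic := minpoly.monic hint
  have hle : (minpoly ℤ ω).natDegree ≤ 2 := by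
    have h := minpoly.isIntegrallyClosed_eq_field_fractions ℚ K hint
    rw [← hmonic.natDegree_map (algebraMap ℤ ℚ), ← h, ← hdeg]
    exact minpoly.natDegree_le _
  have hlt : (p %ₘ minpoly ℤ ω).natDegree < 2 :=
    (Polynomial.natDegree_modByMonic_lt p hmonic (minpoly.ne_one ℤ ω)).trans_le hle
  have hp : Polynomial.aeval ω p = Polynomial.aeval ω (p %ₘ minpoly ℤ ω) :=
    (Polynomial.aeval_modByMonic_eq_self_of_root (minpoly.aeval ℤ ω)).symm
  refine ⟨(p %ₘ minpoly ℤ ω).coeff 0, (p %ₘ minpoly ℤ ω).coeff 1, ?_⟩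
  change Polynomial.aeval ω p = _
  rw [hp, Polynomial.aeval_eq_sum_range' hlt]
  simp [Finset.sum_range_succ]

theorem eq_of_act_eq_act {y : Fin 2 → K} (hy : y ∈ Y K) {g h : Matrix (Fin 2) (Fin 2) ℚ}
    (hgh : act g y = act h y) : g = h := by
  have key : ∀ a b c d : ℚ, (a : K) * y 0 + b * y 1 = c * y 0 + d * y 1 → a = c ∧ b = d := by
    intro a b c d e
    have hac : a = c := by
      by_contra hne
      have hne' : (a : K) - c ≠ 0 := sub_ne_zero.mpr (by exact_mod_cast hne)
      refine hy.2 ((d - b) / (a - c)) ?_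
      simp only [eq_ratCast]
      push_cast
      field_simp
      linear_combination e
    subst hac
    exact ⟨rfl, by exact_mod_cast mul_right_cancel₀ hy.1 (add_left_cancel e)⟩
  ext i j
  have hi := congrFun hgh i
  simp only [act, Matrix.mulVec, dotProduct, Fin.sum_univ_two, Matrix.map_apply,
    eq_ratCast] at hi
  obtain ⟨h0, h1⟩ := key _ _ _ _ hi
  fin_cases j
  · exact h0
  · exact h1

theorem act_mul (g h : Matrix (Fin 2) (Fin 2) ℚ) (y : Fin 2 → K) :
    act (g * h) y = act g (act h y) := by
  rw [act, act, act, Matrix.map_mul, Matrix.mulVec_mulVec]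

theorem act_rsc (g : Matrix (Fin 2) (Fin 2) ℚ) (y : Fin 2 → K) (c : K) :
    act g (rsc y c) = rsc (act g y) c := by
  ext i
  simp only [act, rsc, Matrix.mulVec, dotProduct, Fin.sum_univ_two]
  ring

theorem exists_int_matrix_act (hdeg : Module.finrank ℚ K = 2) {ω : 𝓞 K}
    (hω : Algebra.adjoin ℤ {ω} = ⊤) (x : 𝓞 K) :
    ∃ G : Matrix (Fin 2) (Fin 2) ℤ, act (G.map (Int.cast : ℤ → ℚ)) ![(ω : K), 1] =
      rsc ![(ω : K), 1] (x : K) := by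
  obtain ⟨a, b, h⟩ := exists_eq_add_mul_of_adjoin_eq_top hdeg hω x
  obtain ⟨c, d, h'⟩ := exists_eq_add_mul_of_adjoin_eq_top hdeg hω (ω * x)
  refine ⟨!![d, c; b, a], ?_⟩
  have h1 := congrArg (algebraMap (𝓞 K) K) h
  have h2 := congrArg (algebraMap (𝓞 K) K) h'
  simp only [map_add, map_mul, map_intCast] at h1 h2
  ext i
  fin_cases i
  · simp [act, rsc, Matrix.mulVec, dotProduct, Fin.sum_univ_two]
    linear_combination -h2
  · simp [act, rsc, Matrix.mulVec, dotProduct, Fin.sum_univ_two]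
    linear_combination -h1

theorem isUnit_of_act_eq_rsc_unit (hdeg : Module.finrank ℚ K = 2) {ω : 𝓞 K}
    (hω : Algebra.adjoin ℤ {ω} = ⊤) (hωY : (![(ω : K), 1] : Fin 2 → K) ∈ Y K) (u : (𝓞 K)ˣ)
    {G : Matrix (Fin 2) (Fin 2) ℤ} (hG : act (G.map (Int.cast : ℤ → ℚ)) ![(ω : K), 1] =
      rsc ![(ω : K), 1] ((u : 𝓞 K) : K)) : IsUnit G := by
  obtain ⟨G', hG'⟩ := exists_int_matrix_act hdeg hω ((u⁻¹ : (𝓞 K)ˣ) : 𝓞 K)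
  have huv : (((u⁻¹ : (𝓞 K)ˣ) : 𝓞 K) : K) * ((u : 𝓞 K) : K) = 1 := by
    rw [← map_mul, u.inv_mul, map_one]
  have hmul : G.map (Int.cast : ℤ → ℚ) * G'.map (Int.cast : ℤ → ℚ) = 1 := by
    refine eq_of_act_eq_act hωY ?_
    rw [act_mul, hG', act_rsc, hG]
    ext i
    simp only [rsc, act, mul_assoc]
    rw [mul_comm ((u : 𝓞 K) : K), huv]
    simp
  refine (Matrix.isUnit_iff_isUnit_det G).mpr (IsUnit.of_mul_eq_one G'.det ?_)
  rw [← Matrix.det_mul]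
  have : G * G' = 1 := by
    refine Matrix.map_injective (Int.cast_injective (α := ℚ)) ?_
    change (G * G').map (Int.castRingHom ℚ) = (1 : Matrix _ _ ℤ).map (Int.castRingHom ℚ)
    rw [Matrix.map_mul]
    simpa using hmul
  rw [this, Matrix.det_one]

theorem ratRed_intCast (n : ℕ) (z : ℤ) : ratRed n (z : ℚ) = (z : ZMod n) := by
  simp [ratRed]

theorem map_ratRed_map_intCast (n : ℕ) (G : Matrix (Fin 2) (Fin 2) ℤ) :
    (G.map (Int.cast : ℤ → ℚ)).map (ratRed n) = G.map (Int.castRingHom (ZMod n)) := by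
  ext i j
  simp [ratRed_intCast]

theorem map_intCast_mem_S0set (n : ℕ) {G : Matrix (Fin 2) (Fin 2) ℤ} (hG : IsUnit G) :
    G.map (Int.cast : ℤ → ℚ) ∈ S0set n := by
  have hdet := (Matrix.isUnit_iff_isUnit_det G).mp hG
  refine ⟨?_, fun i j => by simp, ?_⟩
  · have h := hdet.map (Int.castRingHom ℚ)
    rw [RingHom.map_det] at h
    exact h
  · have h := hdet.map (Int.castRingHom (ZMod n))
    rw [RingHom.map_det] at h
    rw [map_ratRed_map_intCast]
    exact h

theorem unit_mem_KSset_iff (hdeg : Module.finrank ℚ K = 2) {ω : 𝓞 K}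
    (hω : Algebra.adjoin ℤ {ω} = ⊤) (hωY : (![(ω : K), 1] : Fin 2 → K) ∈ Y K) (n m : ℕ)
    (u : (𝓞 K)ˣ) : ((u : 𝓞 K) : K) ∈ KSset K n m (ω : K) ↔ (m : 𝓞 K) ∣ u - 1 := by
  constructor
  · rintro ⟨g, ⟨-, hg⟩, hgu⟩
    obtain ⟨G, hG⟩ := exists_int_matrix_act hdeg hω (u : 𝓞 K)
    obtain rfl : g = G.map (Int.cast : ℤ → ℚ) := eq_of_act_eq_act hωY (hgu.trans hG.symm)
    rw [map_ratRed_map_intCast] at hg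
    have h0 : ((G 1 0 : ℤ) : ZMod m) = 0 := by simpa using congrFun (congrFun hg 1) 0
    have h1 : ((G 1 1 - 1 : ℤ) : ZMod m) = 0 := by
      have := congrFun (congrFun hg 1) 1
      simp only [Matrix.map_apply, eq_intCast, Matrix.one_apply_eq] at this
      simp [this]
    obtain ⟨a, ha⟩ := (ZMod.intCast_zmod_eq_zero_iff_dvd _ _).mp h0
    obtain ⟨b, hb⟩ := (ZMod.intCast_zmod_eq_zero_iff_dvd _ _).mp h1
    refine ⟨a * ω + b, RingOfIntegers.coe_injective ?_⟩
    have e := congrFun hG 1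
    simp [act, rsc, Matrix.mulVec, dotProduct, Fin.sum_univ_two] at e
    have ha' : (G 1 0 : K) = m * a := by exact_mod_cast congrArg (Int.cast : ℤ → K) ha
    have hb' : (G 1 1 : K) - 1 = m * b := by exact_mod_cast congrArg (Int.cast : ℤ → K) hb
    simp only [map_sub, map_one, map_mul, map_add, map_natCast, map_intCast]
    linear_combination -e + (ω : K) * ha' + hb'
  · rintro ⟨v, hv⟩
    obtain ⟨V, hV⟩ := exists_int_matrix_act hdeg hω v
    have hG : act ((1 + V.map fun z => (m : ℤ) * z).map (Int.cast : ℤ → ℚ)) ![(ω : K), 1] =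
        rsc ![(ω : K), 1] ((u : 𝓞 K) : K) := by
      have hv' := congrArg (algebraMap (𝓞 K) K) hv
      simp only [map_sub, map_one, map_mul, map_natCast] at hv'
      ext i
      have e := congrFun hV i
      fin_cases i <;>
      · simp [act, rsc, Matrix.mulVec, dotProduct, Fin.sum_univ_two] at e ⊢
        first
        | linear_combination (m : K) * e - (ω : K) * hv'
        | linear_combination (m : K) * e - hv'
    refine ⟨_, ⟨map_intCast_mem_S0set n (isUnit_of_act_eq_rsc_unit hdeg hω hωY u hG), ?_⟩, hG⟩
    rw [map_ratRed_map_intCast]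
    ext i j
    by_cases hij : i = j <;> simp [Matrix.one_apply, hij]

theorem qstar_unit (𝔽 : Type*) [Field 𝔽] (u : (𝓞 K)ˣ) : qstar K 𝔽 ((u : 𝓞 K) : K) = 1 := by
  have h := IsLocalization.sec_spec (nonZeroDivisors (𝓞 K)) ((u : 𝓞 K) : K)
  rw [← map_mul] at h
  have h' := RingOfIntegers.coe_injective h
  have hspan : Ideal.span {(IsLocalization.sec (nonZeroDivisors (𝓞 K)) ((u : 𝓞 K) : K)).1} =
      Ideal.span {((IsLocalization.sec (nonZeroDivisors (𝓞 K)) ((u : 𝓞 K) : K)).2 : 𝓞 K)} := by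
    rw [← h', Ideal.span_singleton_mul_left_unit u.isUnit]
  rw [qstar, inertCount, inertCount, hspan]
  exact Even.neg_one_pow ⟨_, rfl⟩

theorem pow_or_neg_pow_mem_KSqSet_iff (hdeg : Module.finrank ℚ K = 2) {ω : 𝓞 K}
    (hω : Algebra.adjoin ℤ {ω} = ⊤) (hωY : (![(ω : K), 1] : Fin 2 → K) ∈ Y K)
    (𝔽 : Type*) [Field 𝔽] (n m : ℕ) (ε : (𝓞 K)ˣ) (j : ℕ) :
    (((ε : 𝓞 K) : K) ^ j ∈ KSqSet K 𝔽 n m (ω : K) ∨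
      -(((ε : 𝓞 K) : K) ^ j) ∈ KSqSet K 𝔽 n m (ω : K)) ↔ ε ^ j ∈ unitsCongrSign K m := by
  have key : ∀ u : (𝓞 K)ˣ,
      ((u : 𝓞 K) : K) ∈ KSqSet K 𝔽 n m (ω : K) ↔ (m : 𝓞 K) ∣ u - 1 := fun u =>
    (and_iff_left (qstar_unit 𝔽 u)).trans (unit_mem_KSset_iff hdeg hω hωY n m u)
  have h1 : ((ε : 𝓞 K) : K) ^ j = (((ε ^ j : (𝓞 K)ˣ) : 𝓞 K) : K) := by simp
  have h2 : -(((ε : 𝓞 K) : K) ^ j) = (((-ε ^ j : (𝓞 K)ˣ) : 𝓞 K) : K) := by simp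
  rw [h2, h1, key, key]
  refine or_congr Iff.rfl ?_
  rw [Units.val_neg, ← neg_add', dvd_neg]

theorem smulLat_unit_of_isIdealistic {L : Submodule ℤ K} (hL : IsIdealistic K L)
    (u : (𝓞 K)ˣ) : smulLat ((u : 𝓞 K) : K) L = L := by
  obtain ⟨J, hJ⟩ := hL
  have hmem : ∀ x : K, x ∈ L ↔ x ∈ J := fun x => (Set.ext_iff.mp hJ x).symm
  ext x
  simp only [smulLat, Submodule.mem_map, LinearMap.mulLeft_apply, hmem]
  constructor
  · rintro ⟨z, hz, rfl⟩
    exact Algebra.smul_def (u : 𝓞 K) z ▸ J.smul_mem _ hz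
  · intro hx
    refine ⟨((u⁻¹ : (𝓞 K)ˣ) : 𝓞 K) • x, J.smul_mem _ hx, ?_⟩
    rw [Algebra.smul_def, ← mul_assoc, ← map_mul, u.mul_inv, map_one, one_mul]

theorem isIdealistic_lat_generator (hdeg : Module.finrank ℚ K = 2) {ω : 𝓞 K}
    (hω : Algebra.adjoin ℤ {ω} = ⊤) : IsIdealistic K (lat (![(ω : K), 1] : Fin 2 → K)) := by
  refine ⟨LinearMap.range (Algebra.linearMap (𝓞 K) K), ?_⟩
  ext x
  simp only [lat, SetLike.mem_coe, LinearMap.mem_range, Algebra.linearMap_apply,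
    Matrix.cons_val_zero, Matrix.cons_val_one, Submodule.mem_span_pair]
  constructor
  · rintro ⟨z, rfl⟩
    obtain ⟨a, b, rfl⟩ := exists_eq_add_mul_of_adjoin_eq_top hdeg hω z
    exact ⟨b, a, by simp [add_comm]⟩
  · rintro ⟨a, b, rfl⟩
    exact ⟨a * ω + b, by simp⟩

end Lemmas

theorem dvd_of_isLeast_pow_mem {G : Type*} [Group G] (H : Subgroup G) (g : G) {i m : ℕ}
    (hi : IsLeast {j : ℕ | 0 < j ∧ g ^ j ∈ H} i) (hm : g ^ m ∈ H) : i ∣ m := by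
  by_contra hnd
  have hpos : 0 < m % i := Nat.pos_of_ne_zero fun h => hnd (Nat.dvd_of_mod_eq_zero h)
  refine (Nat.mod_lt m hi.1.1).not_ge (hi.2 ⟨hpos, ?_⟩)
  rw [← Nat.div_add_mod m i, pow_add, pow_mul] at hm
  exact (H.mul_mem_cancel_left (H.pow_mem hi.1.2 _)).mp hm

/-- STATEMENT 9.  (i) For every `x ∈ X_{S,q}`, the integer `i^S` divides `m_x`.
(ii) If `x ∈ X_{S,q}` is idealistic, then `m_x = i^S`.  Here, for `x` represented by
`y ∈ Y`, `m_x` is the smallest positive integer `m` such that `ε^m Λ_y = Λ_y` and at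
least one of `ε^m, -ε^m` lies in `K_{S,q}`; and `i^S = m_{ω̃}` where `ω̃` is the class
of `ω̄ = (ω,1)ᵀ`. -/
theorem statement_9 (K : Type) [Field K] [NumberField K]
    (hdeg : Module.finrank ℚ K = 2) (hreal : Nonempty (K →+* ℝ))
    (ω : 𝓞 K) (hω : Algebra.adjoin ℤ {ω} = ⊤)
    (hωY : (![algebraMap (𝓞 K) K ω, 1] : Fin 2 → K) ∈ Y K)
    (ε : (𝓞 K)ˣ) (hε : ∀ u : (𝓞 K)ˣ, ∃ n : ℤ, u = ε ^ n ∨ u = -ε ^ n)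
    (𝔽 : Type) [Field 𝔽] (hchar : ringChar 𝔽 ≠ 2)
    (N Mlev : ℕ) (hN : 0 < N) (hMlev : 3 ≤ Mlev) (hdvd : Mlev ∣ pdN 𝔽 K N)
    (y : Ysub K) (iS mx : ℕ)
    (hiS : IsLeast {j : ℕ | 0 < j ∧
        smulLat ((algebraMap (𝓞 K) K (ε : 𝓞 K)) ^ j)
            (lat (![algebraMap (𝓞 K) K ω, 1] : Fin 2 → K)) =
          lat (![algebraMap (𝓞 K) K ω, 1] : Fin 2 → K) ∧
        ((algebraMap (𝓞 K) K (ε : 𝓞 K)) ^ j ∈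
            KSqSet K 𝔽 (pdN 𝔽 K N) Mlev (algebraMap (𝓞 K) K ω) ∨
          -((algebraMap (𝓞 K) K (ε : 𝓞 K)) ^ j) ∈
            KSqSet K 𝔽 (pdN 𝔽 K N) Mlev (algebraMap (𝓞 K) K ω))} iS)
    (hmx : IsLeast {j : ℕ | 0 < j ∧
        smulLat ((algebraMap (𝓞 K) K (ε : 𝓞 K)) ^ j) (lat y.1) = lat y.1 ∧
        ((algebraMap (𝓞 K) K (ε : 𝓞 K)) ^ j ∈
            KSqSet K 𝔽 (pdN 𝔽 K N) Mlev (algebraMap (𝓞 K) K ω) ∨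
          -((algebraMap (𝓞 K) K (ε : 𝓞 K)) ^ j) ∈
            KSqSet K 𝔽 (pdN 𝔽 K N) Mlev (algebraMap (𝓞 K) K ω))} mx) :
    iS ∣ mx ∧ (IsIdealistic K (lat y.1) → mx = iS) := by
  have hpow : ∀ (L : Submodule ℤ K), IsIdealistic K L → ∀ j : ℕ,
      smulLat ((algebraMap (𝓞 K) K (ε : 𝓞 K)) ^ j) L = L := fun L hL j => by
    simpa using smulLat_unit_of_isIdealistic hL (ε ^ j)
  have hiff := pow_or_neg_pow_mem_KSqSet_iff hdeg hω hωY 𝔽 (pdN 𝔽 K N) Mlev ε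
  simp only [hiff, hpow _ (isIdealistic_lat_generator hdeg hω), true_and] at hiS hmx
  refine ⟨dvd_of_isLeast_pow_mem _ ε hiS hmx.1.2.2, fun hL => ?_⟩
  simp only [hpow _ hL, true_and] at hmx
  exact hmx.unique hiS

end AD
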